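/- arXiv:math/0201132 — 4 statements merged into one kernel-verified Lean document; each statement's English description precedes it below -/
import Mathlib

section
/- Let A and B be disjoint subsets of a topological space, with A locally closed. If A ⊆ closure(B) and B ⊆ closure(A), then A is empty. In particular, two disjoint nonempty subsets of a topological space, at least one of which is locally closed, cannot each be contained in the closure of the other. -/
/-- Let `A` and `B` be disjoint subsets of a topological space, with `A`
locally closed.  If `A ⊆ closure B` and `B ⊆ closure A`, then `A` is empty. -/
theorem stmt_1 {X : Type*} [TopologicalSpace X] (A B : Set X)
    (hdisj : Disjoint A B) (hA : IsLocallyClosed A)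
    (hAB : A ⊆ closure B) (hBA : B ⊆ closure A) : A = ∅ := by
  obtain ⟨U, Z, hU, hZ, rfl⟩ := hA
  refine Set.eq_empty_of_forall_notMem fun x hx => ?_
  obtain ⟨y, hyU, hyB⟩ := mem_closure_iff.mp (hAB hx) U hU hx.1
  have hyZ : y ∈ Z := closure_minimal Set.inter_subset_right hZ (hBA hyB)
  exact Set.disjoint_left.mp hdisj ⟨hyU, hyZ⟩ hyB
end

section
/- Let {M_α}_{α∈A} be a partition of a topological space M into nonempty locally closed subsets satisfying the frontier condition. If M_α ⊆ Fr(M_β) and M_β ⊆ Fr(M_γ) for indices α, β, γ ∈ A, then M_α ⊆ Fr(M_γ). -/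
/-- Let `{M α}` be a partition of a topological space into nonempty
locally closed subsets satisfying the frontier condition (with frontier
`Fr S = closure S \ S`).  If `M α ⊆ Fr (M β)` and `M β ⊆ Fr (M γ)`, then
`M α ⊆ Fr (M γ)`. -/
theorem stmt_2 {X : Type*} [TopologicalSpace X] {A : Type*} (M : A → Set X)
    (hne : ∀ α, (M α).Nonempty)
    (hdisj : ∀ α β, α ≠ β → Disjoint (M α) (M β))
    (hcover : ⋃ α, M α = Set.univ)
    (hlc : ∀ α, IsLocallyClosed (M α))
    (hfr : ∀ α β, M β ⊆ closure (M α) \ M α ∨ M β ∩ (closure (M α) \ M α) = ∅)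
    (α β γ : A)
    (hαβ : M α ⊆ closure (M β) \ M β)
    (hβγ : M β ⊆ closure (M γ) \ M γ) :
    M α ⊆ closure (M γ) \ M γ := by
  have hclosed : IsClosed (closure (M γ) \ M γ) :=
    isOpen_compl_iff.mp (hlc γ).isOpen_coborder
  exact fun x hx => closure_minimal hβγ hclosed (hαβ hx).1
end

section
/- Let {M_α}_{α∈A} be a locally finite partition of a metric space M into nonempty locally closed subsets satisfying the frontier condition. Then one can choose, for each α ∈ A, an open set O_α containing M_α such that: (i) O_α ∩ M_β ≠ ∅ if and only if α ⪯ β; and (ii) O_α ∩ O_β ≠ ∅ implies that α and β are comparable with respect to ⪯ (i.e. α ⪯ β or β ⪯ α). -/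
/-- Around every point there is a ball meeting only those members of a locally finite family
whose closure contains the point. -/
theorem LocallyFinite.exists_ball_inter_nonempty_imp_mem_closure {X ι : Type*}
    [PseudoMetricSpace X] {f : ι → Set X} (hf : LocallyFinite f) (x : X) :
    ∃ r > 0, ∀ i, (Metric.ball x r ∩ f i).Nonempty → x ∈ closure (f i) := by
  obtain ⟨r, hr, hball⟩ := Metric.mem_nhds_iff.1
    (hf.closure.iInter_compl_mem_nhds (fun _ => isClosed_closure) x)
  refine ⟨r, hr, fun i ⟨y, hy, hyi⟩ => ?_⟩
  by_contra hx
  exact Set.mem_iInter₂.1 (hball hy) i hx (subset_closure hyi)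

/-- Let `{M α}` be a locally finite partition of a metric space into
nonempty locally closed subsets satisfying the frontier condition, and let
`α ⪯ β ↔ α = β ∨ M α ⊆ closure (M β) \ M β`.  Then one can choose, for each `α`, an open
set `O α ⊇ M α` such that `O α` meets `M β` iff `α ⪯ β`, and `O α` meets `O β` only if
`α` and `β` are comparable with respect to `⪯`. -/
theorem stmt_4 {X : Type*} [MetricSpace X] {A : Type*} (M : A → Set X)
    (hne : ∀ α, (M α).Nonempty)
    (hdisj : ∀ α β, α ≠ β → Disjoint (M α) (M β))
    (hcover : ⋃ α, M α = Set.univ)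
    (hlc : ∀ α, IsLocallyClosed (M α))
    (hfr : ∀ α β, M β ⊆ closure (M α) \ M α ∨ M β ∩ (closure (M α) \ M α) = ∅)
    (hlf : LocallyFinite M)
    (le : A → A → Prop)
    (hle : ∀ α β, le α β ↔ α = β ∨ M α ⊆ closure (M β) \ M β) :
    ∃ O : A → Set X,
      (∀ α, IsOpen (O α)) ∧
      (∀ α, M α ⊆ O α) ∧
      (∀ α β, (O α ∩ M β).Nonempty ↔ le α β) ∧
      (∀ α β, (O α ∩ O β).Nonempty → le α β ∨ le β α) := by
  have le_of_mem : ∀ {α β x}, x ∈ M α → x ∈ closure (M β) → le α β := by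
    intro α β x hx hxβ
    refine (hle α β).2 (or_iff_not_imp_left.2 fun hαβ => ?_)
    refine (hfr β α).resolve_right fun h => ?_
    exact Set.eq_empty_iff_forall_notMem.1 h x
      ⟨hx, hxβ, Set.disjoint_left.1 (hdisj α β hαβ) hx⟩
  choose r hr hball using hlf.exists_ball_inter_nonempty_imp_mem_closure
  have hsub : ∀ α, M α ⊆ ⋃ x ∈ M α, Metric.ball x (r x / 2) := fun α x hx =>
    Set.mem_biUnion hx (Metric.mem_ball_self (half_pos (hr x)))
  have hopen : ∀ α, IsOpen (⋃ x ∈ M α, Metric.ball x (r x / 2)) := fun α =>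
    isOpen_biUnion fun _ _ => Metric.isOpen_ball
  refine ⟨fun α => ⋃ x ∈ M α, Metric.ball x (r x / 2), hopen, hsub, fun α β => ⟨?_, ?_⟩, ?_⟩
  · rintro ⟨y, hy, hyβ⟩
    obtain ⟨x, hx, hyx⟩ := Set.mem_iUnion₂.1 hy
    exact le_of_mem hx
      (hball x β ⟨y, Metric.ball_subset_ball (half_le_self (hr x).le) hyx, hyβ⟩)
  · intro h
    obtain ⟨x, hx⟩ := hne α
    have hxβ : x ∈ closure (M β) := by
      rcases (hle α β).1 h with rfl | h
      · exact subset_closure hx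
      · exact (h hx).1
    exact mem_closure_iff.1 hxβ _ (hopen α) (hsub α hx)
  · rintro α β ⟨z, hzα, hzβ⟩
    obtain ⟨x, hx, hzx⟩ := Set.mem_iUnion₂.1 hzα
    obtain ⟨y, hy, hzy⟩ := Set.mem_iUnion₂.1 hzβ
    rw [Metric.mem_ball] at hzx hzy
    have hxy := dist_triangle_left x y z
    rcases le_total (r x) (r y) with h | h
    · exact Or.inr (le_of_mem hy (hball y α ⟨x, Metric.mem_ball.2 (by linarith), hx⟩))
    · exact Or.inl (le_of_mem hx (hball x β ⟨y, Metric.mem_ball'.2 (by linarith), hy⟩))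
end

section
/- Let Ω ⊆ ℝ³ be a bounded open set which is star-shaped with respect to the origin (0 ∈ Ω, and for every x ∈ Ω the segment {t·x : 0 ≤ t ≤ 1} is contained in Ω), and suppose that every ray emanating from the origin intersects the frontier Fr(Ω) = closure(Ω) \ Ω in exactly one point; for a unit vector u let ρ(u) > 0 denote the unique positive real with ρ(u)·u ∈ Fr(Ω). Then the map φ : closure(Ω) → ℝ³ defined by φ(0) = 0 and φ(z) = z / ρ(z/‖z‖) for z ≠ 0 is a homeomorphism from closure(Ω) onto the closed unit ball {x ∈ ℝ³ : ‖x‖ ≤ 1}, which maps Ω onto the open unit ball and Fr(Ω) onto the unit sphere S². -/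
/-- Euclidean three-space. -/
abbrev E3 : Type := EuclideanSpace ℝ (Fin 3)

section StarShaped

variable {E : Type*} [NormedAddCommGroup E] [NormedSpace ℝ E] {s : Set E} {ρ : E → ℝ}

/-- The closure of a star-shaped set is star-shaped. -/
theorem smul_mem_closure_of_star (hstar : ∀ x ∈ s, ∀ t : ℝ, 0 ≤ t → t ≤ 1 → t • x ∈ s)
    {x : E} (hx : x ∈ closure s) {t : ℝ} (ht0 : 0 ≤ t) (ht1 : t ≤ 1) : t • x ∈ closure s :=
  map_mem_closure (continuous_const_smul t) hx fun y hy => hstar y hy t ht0 ht1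

theorem smul_mem_iff_lt_radius (h0 : (0 : E) ∈ s)
    (hstar : ∀ x ∈ s, ∀ t : ℝ, 0 ≤ t → t ≤ 1 → t • x ∈ s) {u : E}
    (hρ : 0 < ρ u ∧ ρ u • u ∈ closure s \ s)
    (huniq : ∀ t : ℝ, 0 < t → t • u ∈ closure s \ s → t = ρ u) {t : ℝ} (ht : 0 ≤ t) :
    t • u ∈ s ↔ t < ρ u := by
  obtain ⟨hpos, hcl, hnot⟩ := hρ
  constructor
  · intro h
    by_contra! hle
    apply hnot
    have ht' : 0 < t := hpos.trans_le hle
    have := hstar _ h (ρ u / t) (by positivity) ((div_le_one ht').2 hle)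
    rwa [smul_smul, div_mul_cancel₀ _ ht'.ne'] at this
  · intro h
    by_contra hn
    have ht' : 0 < t := by
      refine lt_of_le_of_ne ht ?_
      rintro rfl
      exact hn (by simpa using h0)
    have := smul_mem_closure_of_star hstar hcl (t := t / ρ u) (by positivity)
      ((div_le_one hpos).2 h.le)
    rw [smul_smul, div_mul_cancel₀ _ hpos.ne'] at this
    exact h.ne (huniq t ht' ⟨this, hn⟩)

theorem smul_mem_closure_iff_le_radius (h0 : (0 : E) ∈ s)
    (hstar : ∀ x ∈ s, ∀ t : ℝ, 0 ≤ t → t ≤ 1 → t • x ∈ s) {u : E}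
    (hρ : 0 < ρ u ∧ ρ u • u ∈ closure s \ s)
    (huniq : ∀ t : ℝ, 0 < t → t • u ∈ closure s \ s → t = ρ u) {t : ℝ} (ht : 0 ≤ t) :
    t • u ∈ closure s ↔ t ≤ ρ u := by
  have key := smul_mem_iff_lt_radius h0 hstar hρ huniq ht
  constructor
  · intro h
    by_contra! hlt
    exact hlt.ne' (huniq t (hρ.1.trans hlt) ⟨h, fun h' => hlt.not_gt (key.1 h')⟩)
  · intro h
    rcases h.lt_or_eq with h | h
    · exact subset_closure (key.2 h)
    · exact h ▸ hρ.2.1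

/-- The radial function of a star-shaped open set is continuous away from the origin. -/
theorem continuousAt_radius (hopen : IsOpen s)
    (hmem : ∀ u : E, ‖u‖ = 1 → ∀ t : ℝ, 0 ≤ t → (t • u ∈ s ↔ t < ρ u))
    (hmem' : ∀ u : E, ‖u‖ = 1 → ∀ t : ℝ, 0 ≤ t → (t • u ∈ closure s ↔ t ≤ ρ u))
    (hpos : ∀ u : E, ‖u‖ = 1 → 0 < ρ u) {z : E} (hz : z ≠ 0) :
    ContinuousAt (fun w : E => ρ (‖w‖⁻¹ • w)) z := by
  have hn : ∀ w : E, w ≠ 0 → ‖(‖w‖⁻¹ • w)‖ = 1 := fun w hw => by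
    simpa using norm_smul_inv_norm (𝕜 := ℝ) hw
  have hc : ∀ c : ℝ, ContinuousAt (fun w : E => c • (‖w‖⁻¹ • w)) z := fun c =>
    ((continuous_norm.continuousAt.inv₀ (norm_ne_zero_iff.2 hz)).smul continuousAt_id).const_smul c
  have hev : ∀ᶠ w in nhds z, w ≠ 0 := isOpen_ne.mem_nhds hz
  refine tendsto_order.2 ⟨fun a ha => ?_, fun a ha => ?_⟩
  · have h1 : max a 0 • (‖z‖⁻¹ • z) ∈ s :=
      (hmem _ (hn z hz) _ (le_max_right _ _)).2 (max_lt ha (hpos _ (hn z hz)))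
    filter_upwards [hev, (hc (max a 0)).eventually (hopen.mem_nhds h1)] with w hw hw'
    exact (le_max_left _ _).trans_lt ((hmem _ (hn w hw) _ (le_max_right _ _)).1 hw')
  · have ha0 : 0 ≤ a := ((hpos _ (hn z hz)).trans ha).le
    have h1 : a • (‖z‖⁻¹ • z) ∈ (closure s)ᶜ := fun h =>
      ((hmem' _ (hn z hz) _ ha0).1 h).not_gt ha
    filter_upwards [hev, (hc a).eventually (isClosed_closure.isOpen_compl.mem_nhds h1)]
      with w hw hw'
    by_contra! h
    exact hw' ((hmem' _ (hn w hw) _ ha0).2 h)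

end StarShaped

/-- Let `Om ⊆ ℝ³` be a bounded open set, star-shaped with respect to the
origin, such that every ray from the origin meets the frontier `closure Om \ Om` in
exactly one point, at parameter `ρ u > 0` for the unit vector `u` directing the ray.
Then the map `φ` with `φ 0 = 0` and `φ z = z / ρ (z / ‖z‖)` for `z ≠ 0` is a
homeomorphism from `closure Om` onto the closed unit ball, mapping `Om` onto the open
unit ball and the frontier `closure Om \ Om` onto the unit sphere. -/
theorem stmt_7 (Om : Set E3) (hopen : IsOpen Om) (hbdd : Bornology.IsBounded Om)
    (h0 : (0 : E3) ∈ Om)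
    (hstar : ∀ x ∈ Om, ∀ t : ℝ, 0 ≤ t → t ≤ 1 → t • x ∈ Om)
    (ρ : E3 → ℝ)
    (hρ : ∀ u : E3, ‖u‖ = 1 → 0 < ρ u ∧ ρ u • u ∈ closure Om \ Om)
    (huniq : ∀ u : E3, ‖u‖ = 1 → ∀ t : ℝ, 0 < t → t • u ∈ closure Om \ Om → t = ρ u)
    (φ : E3 → E3) (hφ0 : φ 0 = 0)
    (hφ : ∀ z : E3, z ≠ 0 → φ z = (ρ (‖z‖⁻¹ • z))⁻¹ • z) :
    (∃ h : (closure Om) ≃ₜ (Metric.closedBall (0 : E3) 1),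
      ∀ z : closure Om, (h z : E3) = φ (z : E3)) ∧
    φ '' Om = Metric.ball (0 : E3) 1 ∧
    φ '' (closure Om \ Om) = Metric.sphere (0 : E3) 1 := by
  have hmem := fun u hu (t : ℝ) (ht : 0 ≤ t) =>
    smul_mem_iff_lt_radius h0 hstar (hρ u hu) (huniq u hu) ht
  have hmem' := fun u hu (t : ℝ) (ht : 0 ≤ t) =>
    smul_mem_closure_iff_le_radius h0 hstar (hρ u hu) (huniq u hu) ht
  set g : E3 → ℝ := fun w => ρ (‖w‖⁻¹ • w) with hg
  have hφg : ∀ z, z ≠ 0 → φ z = (g z)⁻¹ • z := hφ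
  have hn : ∀ w : E3, w ≠ 0 → ‖(‖w‖⁻¹ • w)‖ = 1 := fun w hw => by
    simpa using norm_smul_inv_norm (𝕜 := ℝ) hw
  have hgpos : ∀ w, w ≠ 0 → 0 < g w := fun w hw => (hρ _ (hn w hw)).1
  have hself : ∀ w : E3, w ≠ 0 → ‖w‖ • (‖w‖⁻¹ • w) = w := fun w hw =>
    smul_inv_smul₀ (norm_ne_zero_iff.2 hw) w
  have hOm : ∀ w, w ≠ 0 → (w ∈ Om ↔ ‖w‖ < g w) := fun w hw => by
    have := hmem _ (hn w hw) ‖w‖ (norm_nonneg w)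
    rwa [hself w hw] at this
  have hcl : ∀ w, w ≠ 0 → (w ∈ closure Om ↔ ‖w‖ ≤ g w) := fun w hw => by
    have := hmem' _ (hn w hw) ‖w‖ (norm_nonneg w)
    rwa [hself w hw] at this
  have hgsmul : ∀ (c : ℝ) (w : E3), 0 < c → g (c • w) = g w := fun c w hc => by
    simp only [hg]
    rw [norm_smul, Real.norm_of_nonneg hc.le, smul_smul, mul_inv, mul_right_comm,
      inv_mul_cancel₀ hc.ne', one_mul]
  have hnorm : ∀ z, z ≠ 0 → ‖φ z‖ = ‖z‖ / g z := fun z hz => by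
    rw [hφg z hz, norm_smul, Real.norm_of_nonneg (inv_pos.2 (hgpos z hz)).le, div_eq_inv_mul]
  have hφne : ∀ z, z ≠ 0 → φ z ≠ 0 := fun z hz => by
    rw [hφg z hz]
    exact smul_ne_zero (inv_pos.2 (hgpos z hz)).ne' hz
  have hφball : ∀ z, φ z ∈ Metric.ball (0 : E3) 1 ↔ z ∈ Om := fun z => by
    rcases eq_or_ne z 0 with rfl | hz
    · simp [hφ0, h0]
    · rw [mem_ball_zero_iff, hnorm z hz, div_lt_one (hgpos z hz), hOm z hz]
  have hφcball : ∀ z, φ z ∈ Metric.closedBall (0 : E3) 1 ↔ z ∈ closure Om := fun z => by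
    rcases eq_or_ne z 0 with rfl | hz
    · simp [hφ0, subset_closure h0]
    · rw [mem_closedBall_zero_iff, hnorm z hz, div_le_one (hgpos z hz), hcl z hz]
  have hinj : Function.Injective φ := by
    intro z w h
    rcases eq_or_ne z 0 with rfl | hz
    · by_contra hw
      exact hφne w (Ne.symm hw) (h ▸ hφ0)
    rcases eq_or_ne w 0 with rfl | hw
    · exact absurd (h.trans hφ0) (hφne z hz)
    rw [hφg z hz, hφg w hw] at h
    have hgzw : g z = g w := by
      rw [← hgsmul _ z (inv_pos.2 (hgpos z hz)), h, hgsmul _ w (inv_pos.2 (hgpos w hw))]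
    rw [hgzw] at h
    exact smul_right_injective E3 (inv_pos.2 (hgpos w hw)).ne' h
  have hsurj : Function.Surjective φ := by
    intro w
    rcases eq_or_ne w 0 with rfl | hw
    · exact ⟨0, hφ0⟩
    · refine ⟨g w • w, ?_⟩
      rw [hφg _ (smul_ne_zero (hgpos w hw).ne' hw), hgsmul _ w (hgpos w hw),
        inv_smul_smul₀ (hgpos w hw).ne']
  have hcont : Continuous φ := by
    refine continuous_iff_continuousAt.2 fun z => ?_
    rcases eq_or_ne z 0 with rfl | hz
    · obtain ⟨r, hr, hball⟩ := Metric.nhds_basis_closedBall.mem_iff.1 (hopen.mem_nhds h0)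
      have hgr : ∀ w, w ≠ 0 → r ≤ g w := fun w hw => by
        refine ((hmem _ (hn w hw) r hr.le).1 (hball ?_)).le
        rw [mem_closedBall_zero_iff, norm_smul, hn w hw, mul_one, Real.norm_of_nonneg hr.le]
      have hle : ∀ w, ‖φ w‖ ≤ ‖w‖ / r := fun w => by
        rcases eq_or_ne w 0 with rfl | hw
        · simp [hφ0]
        · rw [hnorm w hw]
          exact div_le_div_of_nonneg_left (norm_nonneg w) hr (hgr w hw)
      rw [ContinuousAt, hφ0]
      refine squeeze_zero_norm hle ?_
      have : Continuous fun w : E3 => ‖w‖ / r := continuous_norm.div_const r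
      simpa using this.tendsto 0
    · have hgc : ContinuousAt g z :=
        continuousAt_radius hopen hmem hmem' (fun u hu => (hρ u hu).1) hz
      refine ((hgc.inv₀ (hgpos z hz).ne').smul continuousAt_id).congr ?_
      filter_upwards [isOpen_ne.mem_nhds hz] with w hw
      exact (hφg w hw).symm
  have hpre : φ ⁻¹' Metric.ball 0 1 = Om := Set.ext hφball
  have hpre' : φ ⁻¹' Metric.closedBall 0 1 = closure Om := Set.ext hφcball
  refine ⟨?_, ?_, ?_⟩
  · have : CompactSpace (closure Om) := isCompact_iff_compactSpace.1 hbdd.isCompact_closure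
    let f : closure Om → Metric.closedBall (0 : E3) 1 := fun z => ⟨φ z, (hφcball z).2 z.2⟩
    have hf : Function.Bijective f := by
      refine ⟨fun z w h => Subtype.ext (hinj (congrArg Subtype.val h)), fun w => ?_⟩
      obtain ⟨z, hz⟩ := hsurj w
      exact ⟨⟨z, (hφcball z).1 (hz ▸ w.2)⟩, Subtype.ext hz⟩
    have hfc : Continuous f := (hcont.comp continuous_subtype_val).subtype_mk _
    exact ⟨Continuous.homeoOfEquivCompactToT2 (f := Equiv.ofBijective f hf) hfc, fun z => rfl⟩
  · rw [← hpre, Set.image_preimage_eq _ hsurj]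
  · rw [← hpre', ← hpre, ← Set.preimage_sdiff, Set.image_preimage_eq _ hsurj,
      Metric.closedBall_sdiff_ball]
end
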